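/- arXiv:2108.08595 — 6 statements merged into one kernel-verified Lean document; each statement's English description precedes it below -/
import Mathlib

section
/- Let Ω ⊆ ℍ be a nonempty open connected axially symmetric set and fix I ∈ 𝕊. Then exactly one of the following holds: (i) Ω contains a real point and Ω_I is a connected subset of ℂ_I (Ω is a symmetric slice domain); or (ii) Ω contains no real point and Ω_I is the disjoint union of two nonempty open connected sets A and B, each of which is mapped onto the other by quaternionic conjugation q ↦ Re q − Im q (Ω is a product domain). -/
open Quaternion

/-- A set `Ω ⊆ ℍ` is axially symmetric if for all real `x, y` and all imaginary units
`I, J ∈ 𝕊`, `x + y • I ∈ Ω` implies `x + y • J ∈ Ω`. -/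
def AxiallySymmetric (Ω : Set (Quaternion ℝ)) : Prop :=
  ∀ (x y : ℝ) (I J : Quaternion ℝ), I ^ 2 = -1 → J ^ 2 = -1 →
    (x : Quaternion ℝ) + y • I ∈ Ω → (x : Quaternion ℝ) + y • J ∈ Ω

/-- The slice `ℂ_I = ℝ + Iℝ` through an imaginary unit `I`. -/
def Slice (I : Quaternion ℝ) : Set (Quaternion ℝ) :=
  {q | ∃ x y : ℝ, q = (x : Quaternion ℝ) + y • I}

lemma unit_iff (I : Quaternion ℝ) :
    I ^ 2 = -1 ↔ I.re = 0 ∧ I.imI ^ 2 + I.imJ ^ 2 + I.imK ^ 2 = 1 := by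
  constructor
  · intro h
    rw [sq] at h
    have h0 := congrArg QuaternionAlgebra.re h
    have h1 := congrArg QuaternionAlgebra.imI h
    have h2 := congrArg QuaternionAlgebra.imJ h
    have h3 := congrArg QuaternionAlgebra.imK h
    simp at h0 h1 h2 h3
    have hr : I.re = 0 := by
      by_contra hr
      have e1 : I.imI = 0 := by
        apply mul_left_cancel₀ hr; linarith
      have e2 : I.imJ = 0 := by
        apply mul_left_cancel₀ hr; linarith
      have e3 : I.imK = 0 := by
        apply mul_left_cancel₀ hr; linarith
      rw [e1, e2, e3] at h0
      nlinarith [sq_nonneg I.re]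
    refine ⟨hr, ?_⟩
    rw [hr] at h0
    linarith
  · rintro ⟨hr, h⟩
    rw [sq]
    ext
    · simp [hr]; linarith
    · simp [hr]; ring
    · simp [hr]; ring
    · simp [hr]; ring

/-- Norm of the imaginary part. -/
noncomputable def imN (q : Quaternion ℝ) : ℝ := √(q.imI ^ 2 + q.imJ ^ 2 + q.imK ^ 2)

/-- Projection on the closed half-slice through `J`. -/
noncomputable def proj (J q : Quaternion ℝ) : Quaternion ℝ := (q.re : Quaternion ℝ) + imN q • J

lemma proj_cont (J : Quaternion ℝ) : Continuous (proj J) := by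
  have h0 : Continuous (fun q : Quaternion ℝ => q.re) := Quaternion.continuous_re
  have h1 : Continuous (fun q : Quaternion ℝ => q.imI) := Quaternion.continuous_imI
  have h2 : Continuous (fun q : Quaternion ℝ => q.imJ) := Quaternion.continuous_imJ
  have h3 : Continuous (fun q : Quaternion ℝ => q.imK) := Quaternion.continuous_imK
  have hn : Continuous imN := by unfold imN; fun_prop
  unfold proj
  exact (Quaternion.continuous_coe.comp h0).add (hn.smul continuous_const)

lemma exists_unit (q I : Quaternion ℝ) (hI : I ^ 2 = -1) :
    ∃ J : Quaternion ℝ, J ^ 2 = -1 ∧ q = (q.re : Quaternion ℝ) + imN q • J := by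
  have hs : 0 ≤ q.imI ^ 2 + q.imJ ^ 2 + q.imK ^ 2 := by positivity
  by_cases h : imN q = 0
  · refine ⟨I, hI, ?_⟩
    have h' := h
    unfold imN at h'
    rw [Real.sqrt_eq_zero hs] at h'
    rw [h]
    have e1 : q.imI = 0 := by nlinarith [sq_nonneg q.imI, sq_nonneg q.imJ, sq_nonneg q.imK]
    have e2 : q.imJ = 0 := by nlinarith [sq_nonneg q.imI, sq_nonneg q.imJ, sq_nonneg q.imK]
    have e3 : q.imK = 0 := by nlinarith [sq_nonneg q.imI, sq_nonneg q.imJ, sq_nonneg q.imK]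
    ext <;> simp [e1, e2, e3]
  · have hsq : imN q ^ 2 = q.imI ^ 2 + q.imJ ^ 2 + q.imK ^ 2 := Real.sq_sqrt hs
    refine ⟨(imN q)⁻¹ • q.im, ?_, ?_⟩
    · rw [unit_iff]
      refine ⟨by simp, ?_⟩
      simp
      field_simp
      linarith
    · rw [smul_smul, mul_inv_cancel₀ h, one_smul, Quaternion.re_add_im]

lemma imN_slice (x y : ℝ) (J : Quaternion ℝ) (hJ : J ^ 2 = -1) (hy : 0 ≤ y) :
    imN ((x : Quaternion ℝ) + y • J) = y := by
  obtain ⟨-, h⟩ := (unit_iff J).1 hJ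
  unfold imN
  rw [Real.sqrt_eq_iff_mul_self_eq (by positivity) hy]
  simp
  linear_combination (y ^ 2) * h

lemma proj_image (Ω : Set (Quaternion ℝ)) (hax : AxiallySymmetric Ω) (J : Quaternion ℝ)
    (hJ : J ^ 2 = -1) :
    proj J '' Ω = {q | q ∈ Ω ∧ ∃ x y : ℝ, 0 ≤ y ∧ q = (x : Quaternion ℝ) + y • J} := by
  ext p
  constructor
  · rintro ⟨q, hq, rfl⟩
    refine ⟨?_, q.re, imN q, Real.sqrt_nonneg _, rfl⟩
    obtain ⟨K, hK, e⟩ := exists_unit q J hJ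
    rw [e] at hq
    exact hax _ _ K J hK hJ hq
  · rintro ⟨hp, x, y, hy, rfl⟩
    refine ⟨_, hp, ?_⟩
    have hre : ((x : Quaternion ℝ) + y • J).re = x := by
      simp [((unit_iff J).1 hJ).1]
    unfold proj
    rw [imN_slice x y J hJ hy, hre]

/-- The coordinate along `I`. -/
noncomputable def coordI (I q : Quaternion ℝ) : ℝ :=
  q.imI * I.imI + q.imJ * I.imJ + q.imK * I.imK

lemma coordI_cont (I : Quaternion ℝ) : Continuous (coordI I) := by
  have h1 : Continuous (fun q : Quaternion ℝ => q.imI) := Quaternion.continuous_imI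
  have h2 : Continuous (fun q : Quaternion ℝ => q.imJ) := Quaternion.continuous_imJ
  have h3 : Continuous (fun q : Quaternion ℝ => q.imK) := Quaternion.continuous_imK
  unfold coordI; fun_prop

lemma coordI_slice (x y : ℝ) (I : Quaternion ℝ) (hI : I ^ 2 = -1) :
    coordI I ((x : Quaternion ℝ) + y • I) = y := by
  obtain ⟨-, h⟩ := (unit_iff I).1 hI
  unfold coordI
  simp
  linear_combination y * h

lemma star_slice (x y : ℝ) (I : Quaternion ℝ) (hI : I ^ 2 = -1) :
    star ((x : Quaternion ℝ) + y • I) = (x : Quaternion ℝ) + y • (-I) := by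
  obtain ⟨h, -⟩ := (unit_iff I).1 hI
  ext <;> simp [h]

lemma half_open (Ω : Set (Quaternion ℝ)) (hopen : IsOpen Ω) (hr : ∀ q ∈ Ω, q.im ≠ 0)
    (I : Quaternion ℝ) (hI : I ^ 2 = -1) :
    ∃ U : Set (Quaternion ℝ), IsOpen U ∧
      {q | q ∈ Ω ∧ ∃ x y : ℝ, 0 ≤ y ∧ q = (x : Quaternion ℝ) + y • I} = U ∩ Slice I := by
  refine ⟨Ω ∩ {q | 0 < coordI I q},
    hopen.inter (isOpen_lt continuous_const (coordI_cont I)), ?_⟩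
  ext q
  constructor
  · rintro ⟨hq, x, y, hy, rfl⟩
    refine ⟨⟨hq, ?_⟩, x, y, rfl⟩
    show 0 < coordI I _
    rw [coordI_slice x y I hI]
    refine lt_of_le_of_ne hy ?_
    rintro rfl
    exact hr _ hq (by simp)
  · rintro ⟨⟨hq, hc⟩, x, y, rfl⟩
    change 0 < coordI I _ at hc
    rw [coordI_slice x y I hI] at hc
    exact ⟨hq, x, y, hc.le, rfl⟩

lemma star_half (Ω : Set (Quaternion ℝ)) (hax : AxiallySymmetric Ω)
    (I : Quaternion ℝ) (hI : I ^ 2 = -1) :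
    star '' {q | q ∈ Ω ∧ ∃ x y : ℝ, 0 ≤ y ∧ q = (x : Quaternion ℝ) + y • I} =
      {q | q ∈ Ω ∧ ∃ x y : ℝ, 0 ≤ y ∧ q = (x : Quaternion ℝ) + y • (-I)} := by
  have hI' : (-I) ^ 2 = -1 := by rw [neg_sq, hI]
  ext p
  constructor
  · rintro ⟨_, ⟨hq, x, y, hy, rfl⟩, rfl⟩
    rw [star_slice x y I hI]
    exact ⟨hax _ _ _ _ hI hI' hq, x, y, hy, rfl⟩
  · rintro ⟨hq, x, y, hy, rfl⟩
    exact ⟨_, ⟨hax _ _ _ _ hI' hI hq, x, y, hy, rfl⟩, star_slice x y I hI⟩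

/-- Let `Ω ⊆ ℍ` be a nonempty open connected axially symmetric set and fix `I ∈ 𝕊`.
Then exactly one of the following holds: (i) `Ω` contains a real point and `Ω_I` is a
connected subset of `ℂ_I` (symmetric slice domain); or (ii) `Ω` contains no real point
and `Ω_I` is the disjoint union of two nonempty open (in `ℂ_I`) connected sets, each
mapped onto the other by quaternionic conjugation (product domain). -/
theorem stmt1 (Ω : Set (Quaternion ℝ)) (hopen : IsOpen Ω) (hconn : IsConnected Ω)
    (hax : AxiallySymmetric Ω) (I : Quaternion ℝ) (hI : I ^ 2 = -1) :
    Xor'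
      ((∃ q ∈ Ω, q.im = 0) ∧ IsConnected (Ω ∩ Slice I))
      ((∀ q ∈ Ω, q.im ≠ 0) ∧
        ∃ A B : Set (Quaternion ℝ),
          Ω ∩ Slice I = A ∪ B ∧ Disjoint A B ∧
          A.Nonempty ∧ B.Nonempty ∧
          (∃ U : Set (Quaternion ℝ), IsOpen U ∧ A = U ∩ Slice I) ∧
          (∃ V : Set (Quaternion ℝ), IsOpen V ∧ B = V ∩ Slice I) ∧
          IsConnected A ∧ IsConnected B ∧
          (star '' A = B) ∧ (star '' B = A)) := by
  have hI' : (-I) ^ 2 = -1 := by rw [neg_sq, hI]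
  have hA := hconn.image (proj I) (proj_cont I).continuousOn
  have hB := hconn.image (proj (-I)) (proj_cont (-I)).continuousOn
  have hstarA := star_half Ω hax I hI
  have hstarB := star_half Ω hax (-I) hI'
  rw [neg_neg] at hstarB
  rw [proj_image Ω hax I hI] at hA
  rw [proj_image Ω hax (-I) hI'] at hB
  have hslice : Slice (-I) = Slice I := by
    ext q
    constructor
    · rintro ⟨x, y, rfl⟩
      exact ⟨x, -y, by simp⟩
    · rintro ⟨x, y, rfl⟩
      exact ⟨x, -y, by simp⟩
  have hU : Ω ∩ Slice I =
      {q | q ∈ Ω ∧ ∃ x y : ℝ, 0 ≤ y ∧ q = (x : Quaternion ℝ) + y • I} ∪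
      {q | q ∈ Ω ∧ ∃ x y : ℝ, 0 ≤ y ∧ q = (x : Quaternion ℝ) + y • (-I)} := by
    ext q
    constructor
    · rintro ⟨hq, x, y, rfl⟩
      rcases le_total 0 y with hy | hy
      · exact Or.inl ⟨hq, x, y, hy, rfl⟩
      · exact Or.inr ⟨hq, x, -y, by linarith, by simp⟩
    · rintro (⟨hq, x, y, hy, rfl⟩ | ⟨hq, x, y, hy, rfl⟩)
      · exact ⟨hq, x, y, rfl⟩
      · exact ⟨hq, x, -y, by simp⟩
  by_cases hr : ∃ q ∈ Ω, q.im = 0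
  · refine Or.inl ⟨⟨hr, ?_⟩, ?_⟩
    · obtain ⟨q, hq, him⟩ := hr
      have hqr : q = (q.re : Quaternion ℝ) := by
        conv_lhs => rw [← Quaternion.re_add_im q, him, add_zero]
      rw [hU]
      refine IsConnected.union ⟨q, ⟨hq, q.re, 0, le_rfl, ?_⟩, hq, q.re, 0, le_rfl, ?_⟩ hA hB
      · simpa using hqr
      · simpa using hqr
    · rintro ⟨h, -⟩
      obtain ⟨q, hq, him⟩ := hr
      exact h q hq him
  · refine Or.inr ⟨⟨?_, ?_⟩, fun h => hr h.1⟩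
    · intro q hq him
      exact hr ⟨q, hq, him⟩
    · have hr' : ∀ q ∈ Ω, q.im ≠ 0 := fun q hq him => hr ⟨q, hq, him⟩
      have hoB := half_open Ω hopen hr' (-I) hI'
      rw [hslice] at hoB
      refine ⟨_, _, hU, ?_, hA.nonempty, hB.nonempty, half_open Ω hopen hr' I hI, hoB,
        hA, hB, hstarA, hstarB⟩
      rw [Set.disjoint_left]
      rintro q ⟨hq, x, y, hy, rfl⟩ ⟨-, x', y', hy', e⟩
      have e1 := congrArg (coordI I) e
      rw [coordI_slice x y I hI, smul_neg, ← neg_smul, coordI_slice x' (-y') I hI] at e1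
      have hy0 : y = 0 := by linarith
      subst hy0
      exact hr' _ hq (by simp)
end

section
/- For every integer k ≥ 1, the function μ restricted to the set M_k = {z² : z ∈ ℂ, kπ < Re z < (k+1)π} is injective, and its image is exactly ℂ ∖ ((−∞,−1] ∪ [1,+∞)). -/
open Complex

/-- `μ(z) = Σ_{m≥0} (−1)^m z^m/(2m)!`, so that `μ(z²) = cos z`. -/
noncomputable def μ (z : ℂ) : ℂ :=
  ∑' m : ℕ, (-1) ^ m * z ^ m / ((2 * m).factorial : ℂ)

theorem mu_sq (z : ℂ) : μ (z ^ 2) = Complex.cos z := by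
  rw [Complex.cos_eq_tsum]
  unfold μ
  refine tsum_congr fun m => ?_
  rw [← pow_mul]

theorem cos_re_im (z : ℂ) : (Complex.cos z).re = Real.cos z.re * Real.cosh z.im ∧
    (Complex.cos z).im = -(Real.sin z.re * Real.sinh z.im) := by
  have h := Complex.cos_eq z
  rw [← Complex.ofReal_cos, ← Complex.ofReal_cosh, ← Complex.ofReal_sin,
    ← Complex.ofReal_sinh] at h
  rw [h]
  constructor <;> simp only [Complex.sub_re, Complex.sub_im, Complex.mul_re, Complex.mul_im, Complex.ofReal_re,
    Complex.ofReal_im, Complex.I_re, Complex.I_im] <;> ring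

/-- For every integer `k ≥ 1`, `μ` restricted to `M_k = {z² : kπ < Re z < (k+1)π}` is
injective, with image exactly `ℂ ∖ ((−∞,−1] ∪ [1,+∞))`. -/
theorem stmt9 (k : ℤ) (hk : 1 ≤ k) :
    Set.InjOn μ {w : ℂ | ∃ z : ℂ, w = z ^ 2 ∧
      (k : ℝ) * Real.pi < z.re ∧ z.re < (k + 1 : ℝ) * Real.pi} ∧
    μ '' {w : ℂ | ∃ z : ℂ, w = z ^ 2 ∧
      (k : ℝ) * Real.pi < z.re ∧ z.re < (k + 1 : ℝ) * Real.pi} =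
      {w : ℂ | ¬(w.im = 0 ∧ (w.re ≤ -1 ∨ 1 ≤ w.re))} := by
  have hpi := Real.pi_pos
  refine ⟨?_, ?_⟩
  · rintro _ ⟨x, rfl, hx1, hx2⟩ _ ⟨y, rfl, hy1, hy2⟩ h
    rw [mu_sq, mu_sq, Complex.cos_eq_cos_iff] at h
    obtain ⟨n, h | h⟩ := h
    · have hre : y.re = 2 * n * Real.pi + x.re := by
        rw [h]; simp
      have h1 : (2 * n : ℝ) < 1 := lt_of_mul_lt_mul_right (by linarith) hpi.le
      have h2 : (-1 : ℝ) < 2 * n := lt_of_mul_lt_mul_right (by linarith) hpi.le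
      have h1' : 2 * n < 1 := by exact_mod_cast h1
      have h2' : -1 < 2 * n := by exact_mod_cast h2
      have : n = 0 := by omega
      subst this
      rw [h]; simp
    · exfalso
      have hre : y.re = 2 * n * Real.pi - x.re := by
        rw [h]; simp
      have h1 : (2 * n : ℝ) < 2 * k + 2 := lt_of_mul_lt_mul_right (by linarith) hpi.le
      have h2 : (2 * k : ℝ) < 2 * n := lt_of_mul_lt_mul_right (by linarith) hpi.le
      have h1' : 2 * n < 2 * k + 2 := by exact_mod_cast h1
      have h2' : 2 * k < 2 * n := by exact_mod_cast h2
      omega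
  · ext w
    constructor
    · rintro ⟨_, ⟨z, rfl, h1, h2⟩, rfl⟩
      rw [mu_sq]
      obtain ⟨hr, hi⟩ := cos_re_im z
      rintro ⟨him, hre⟩
      have hs : Real.sin z.re ≠ 0 := by
        intro h0
        obtain ⟨n, hn⟩ := Real.sin_eq_zero_iff.1 h0
        rw [← hn] at h1 h2
        have a1 : (k : ℝ) < n := lt_of_mul_lt_mul_right h1 hpi.le
        have a2 : (n : ℝ) < k + 1 := lt_of_mul_lt_mul_right h2 hpi.le
        have a1' : k < n := by exact_mod_cast a1
        have a2' : n < k + 1 := by exact_mod_cast a2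
        omega
      rw [hi, neg_eq_zero, mul_eq_zero] at him
      have hy : z.im = 0 := Real.sinh_eq_zero.1 (him.resolve_left hs)
      rw [hr, hy, Real.cosh_zero, mul_one] at hre
      have := Real.sin_sq_add_cos_sq z.re
      have : 0 < Real.sin z.re ^ 2 := by positivity
      rcases hre with h | h <;> nlinarith
    · intro hw
      obtain ⟨z, rfl⟩ := Complex.cos_surjective w
      have hs : Real.sin z.re ≠ 0 := by
        intro h0
        apply hw
        obtain ⟨hr, hi⟩ := cos_re_im z
        refine ⟨by rw [hi, h0]; simp, ?_⟩
        rw [hr]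
        have hc := Real.one_le_cosh z.im
        rcases Real.sin_eq_zero_iff_cos_eq.1 h0 with h | h
        · right; rw [h]; linarith
        · left; rw [h]; linarith
      obtain ⟨n, hn⟩ : ∃ n : ℤ, n = ⌊z.re / Real.pi⌋ := ⟨_, rfl⟩
      have f1 : (n : ℝ) * Real.pi ≤ z.re := by
        rw [← le_div_iff₀ hpi, hn]; exact Int.floor_le _
      have f2 : z.re < (n + 1 : ℝ) * Real.pi := by
        rw [← div_lt_iff₀ hpi, hn]; exact Int.lt_floor_add_one _
      have f1' : (n : ℝ) * Real.pi < z.re := by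
        refine lt_of_le_of_ne f1 fun h => hs ?_
        rw [← h]; exact Real.sin_int_mul_pi n
      rcases Int.even_or_odd' (k - n) with ⟨m, hm | hm⟩
      · have hm' : (k : ℝ) = n + 2 * m := by
          have : k = n + 2 * m := by omega
          exact_mod_cast this
        refine ⟨_, ⟨2 * m * Real.pi + z, rfl, ?_, ?_⟩, ?_⟩
        · simp; rw [hm']; linarith
        · simp; rw [hm']; linarith
        · rw [mu_sq]; exact (Complex.cos_eq_cos_iff.2 ⟨m, Or.inl rfl⟩).symm
      · have hm' : (k : ℝ) = n + 2 * m + 1 := by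
          have : k = n + 2 * m + 1 := by omega
          exact_mod_cast this
        refine ⟨_, ⟨2 * ((n + m + 1 : ℤ) : ℂ) * Real.pi - z, rfl, ?_, ?_⟩, ?_⟩
        · simp; rw [hm']; linarith
        · simp; rw [hm']; linarith
        · rw [mu_sq]; exact (Complex.cos_eq_cos_iff.2 ⟨n + m + 1, Or.inr rfl⟩).symm
end

section
/- The function μ restricted to the set M_0 = {z² : z ∈ ℂ, 0 ≤ Re z < π} is injective, and its image is exactly ℂ ∖ (−∞,−1]. -/
open Complex

theorem exists_strip (w : ℂ) : ∃ z : ℂ, Complex.cos z = w ∧ 0 ≤ z.re ∧ z.re ≤ Real.pi := by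
  obtain ⟨z, hz⟩ := Complex.cos_surjective w
  have hpi := Real.pi_pos
  obtain ⟨k, hk, -⟩ := existsUnique_add_zsmul_mem_Ioc (Real.two_pi_pos) z.re (-Real.pi)
  have hc : Complex.cos (z + k * (2 * Real.pi)) = w := by
    rw [Complex.cos_add_int_mul_two_pi, hz]
  have hre : (z + k * (2 * Real.pi)).re = z.re + k * (2 * Real.pi) := by simp
  simp only [zsmul_eq_mul, Set.mem_Ioc] at hk
  rcases le_total 0 (z.re + k * (2 * Real.pi)) with h | h
  · exact ⟨_, hc, by rw [hre]; exact h, by rw [hre]; linarith [hk.2]⟩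
  · refine ⟨-(z + k * (2 * Real.pi)), by rw [Complex.cos_neg, hc], ?_, ?_⟩
    · rw [Complex.neg_re, hre]; linarith
    · rw [Complex.neg_re, hre]; linarith [hk.1]

/-- `μ` restricted to `M_0 = {z² : 0 ≤ Re z < π}` is injective, with image exactly
`ℂ ∖ (−∞,−1]`. -/
theorem stmt10 :
    Set.InjOn μ {w : ℂ | ∃ z : ℂ, w = z ^ 2 ∧ 0 ≤ z.re ∧ z.re < Real.pi} ∧
    μ '' {w : ℂ | ∃ z : ℂ, w = z ^ 2 ∧ 0 ≤ z.re ∧ z.re < Real.pi} =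
      {w : ℂ | ¬(w.im = 0 ∧ w.re ≤ -1)} := by
  have hpi := Real.pi_pos
  constructor
  · rintro _ ⟨z, rfl, hz0, hz1⟩ _ ⟨w, rfl, hw0, hw1⟩ h
    rw [mu_sq, mu_sq, Complex.cos_eq_cos_iff] at h
    obtain ⟨k, h | h⟩ := h
    · have hre : w.re = 2 * k * Real.pi + z.re := by
        rw [h]; simp
      have h1 : k < 1 := by
        by_contra hk
        have : (1 : ℝ) ≤ k := by exact_mod_cast not_lt.mp hk
        nlinarith
      have h2 : -1 < k := by
        by_contra hk
        have : (k : ℝ) ≤ -1 := by exact_mod_cast not_lt.mp hk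
        nlinarith
      have h0 : k = 0 := by omega
      subst h0
      rw [h]; simp
    · have hre : w.re = 2 * k * Real.pi - z.re := by
        rw [h]; simp
      have h1 : k < 1 := by
        by_contra hk
        have : (1 : ℝ) ≤ k := by exact_mod_cast not_lt.mp hk
        nlinarith
      have h2 : -1 < k := by
        by_contra hk
        have : (k : ℝ) ≤ -1 := by exact_mod_cast not_lt.mp hk
        nlinarith
      have h0 : k = 0 := by omega
      subst h0
      rw [h]; simp
  · ext w
    simp only [Set.mem_image, Set.mem_ofPred_eq]
    constructor
    · rintro ⟨_, ⟨z, rfl, h0, h1⟩, rfl⟩ ⟨him, hre⟩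
      rw [mu_sq] at him hre
      rw [(cos_re_im z).2, neg_eq_zero, mul_eq_zero] at him
      rw [(cos_re_im z).1] at hre
      have hc := Real.one_le_cosh z.im
      rcases him with h | h
      · have hx : z.re = 0 := by
          by_contra hne
          exact (Real.sin_pos_of_pos_of_lt_pi (lt_of_le_of_ne h0 (Ne.symm hne)) h1).ne' h
        rw [hx, Real.cos_zero] at hre
        linarith
      · rw [Real.sinh_eq_zero] at h
        rw [h, Real.cosh_zero, mul_one] at hre
        have := Real.cos_lt_cos_of_nonneg_of_le_pi h0 le_rfl h1
        rw [Real.cos_pi] at this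
        linarith
    · intro hw
      obtain ⟨z, hz, h0, h1⟩ := exists_strip w
      refine ⟨z ^ 2, ⟨z, rfl, h0, lt_of_le_of_ne h1 ?_⟩, by rw [mu_sq, hz]⟩
      intro hx
      apply hw
      rw [← hz, (cos_re_im z).1, (cos_re_im z).2, hx, Real.cos_pi, Real.sin_pi]
      have hc := Real.one_le_cosh z.im
      exact ⟨by simp, by linarith⟩
end

section
/- Let U ⊆ ℂ be a nonempty open, connected and simply connected set, and let a, b : U → ℂ be holomorphic functions satisfying a(z)² + b(z)² = 1 for all z ∈ U. Then there exists a holomorphic function φ : U → ℂ such that cos(φ(z)) = a(z) and sin(φ(z)) = b(z) for all z ∈ U. -/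
open Complex

/-- A continuous logarithm of a holomorphic function is holomorphic. -/
theorem differentiableOn_of_exp_eq {U : Set ℂ} (hopen : IsOpen U) {f g : ℂ → ℂ}
    (hf : ContinuousOn f U) (hg : DifferentiableOn ℂ g U)
    (h : ∀ z ∈ U, exp (f z) = g z) : DifferentiableOn ℂ f U := by
  intro z hz
  have hU : U ∈ nhds z := hopen.mem_nhds hz
  have hfz : ContinuousAt f z := hf.continuousAt hU
  have hgz : DifferentiableAt ℂ g z := hg.differentiableAt hU
  have hz0 : g z ≠ 0 := by rw [← h z hz]; exact exp_ne_zero _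
  have hd : DifferentiableAt ℂ (fun w => f z + log (g w / g z)) z := by
    refine (differentiableAt_const _).add ((hgz.div_const _).clog ?_)
    rw [div_self hz0]
    exact one_mem_slitPlane
  refine DifferentiableAt.differentiableWithinAt (hd.congr_of_eventuallyEq ?_)
  have hnear : ∀ᶠ w in nhds z, ‖f w - f z‖ < 1 := by
    have := Metric.continuousAt_iff'.1 hfz 1 one_pos
    simpa [dist_eq_norm] using this
  filter_upwards [hU, hnear] with w hw hlt
  have him : |(f w - f z).im| < 1 := (abs_im_le_norm _).trans_lt hlt
  have h1 := abs_lt.1 him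
  have hpi := Real.pi_gt_three
  rw [← h w hw, ← h z hz, ← exp_sub, log_exp (by linarith) (by linarith)]
  ring

/-- Let `U ⊆ ℂ` be a nonempty open, connected and simply connected set, and let
`a, b : U → ℂ` be holomorphic with `a² + b² = 1` on `U`. Then there is a holomorphic
`φ : U → ℂ` with `cos ∘ φ = a` and `sin ∘ φ = b` on `U`. -/
theorem stmt16 (U : Set ℂ) (hne : U.Nonempty) (hopen : IsOpen U)
    (hconn : IsConnected U) (hsc : SimplyConnectedSpace U)
    (a b : ℂ → ℂ) (ha : DifferentiableOn ℂ a U) (hb : DifferentiableOn ℂ b U)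
    (hab : ∀ z ∈ U, a z ^ 2 + b z ^ 2 = 1) :
    ∃ φ : ℂ → ℂ, DifferentiableOn ℂ φ U ∧
      ∀ z ∈ U, Complex.cos (φ z) = a z ∧ Complex.sin (φ z) = b z := by
  have hg : DifferentiableOn ℂ (fun z => a z + b z * I) U := ha.add (hb.mul_const I)
  have hmul : ∀ z ∈ U, (a z + b z * I) * (a z - b z * I) = 1 := by
    intro z hz
    linear_combination hab z hz - b z ^ 2 * I_sq
  have h0 : (0 : ℂ) ∉ (fun z => a z + b z * I) '' U := by
    rintro ⟨z, hz, h⟩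
    have h2 := hmul z hz
    simp only at h
    rw [h, zero_mul] at h2
    exact zero_ne_one h2
  obtain ⟨f, hfc, hf⟩ := exists_continuousOn_eqOn_exp_comp (U := U) hsc hopen hg.continuousOn h0
  have hf' : ∀ z ∈ U, exp (f z) = a z + b z * I := fun z hz => hf hz
  refine ⟨fun z => f z * (-I),
    (differentiableOn_of_exp_eq hopen hfc hg hf').mul_const _, fun z hz => ?_⟩
  have e1 : f z * (-I) * I = f z := by linear_combination (-f z) * I_sq
  have hinv : exp (-f z) = a z - b z * I := by
    rw [exp_neg, hf' z hz]
    exact inv_eq_of_mul_eq_one_right (hmul z hz)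
  have e2 : -(f z * (-I)) * I = -f z := by linear_combination (f z) * I_sq
  constructor
  · rw [Complex.cos, e1, e2, hf' z hz, hinv]
    ring
  · rw [Complex.sin, e1, e2, hf' z hz, hinv]
    linear_combination (-b z) * I_sq
end

section
/- Let Ω ⊆ ℂ be a nonempty open, connected and simply connected set that is invariant under complex conjugation, and let g be a function holomorphic on Ω, nonvanishing on Ω, and satisfying g(z̄) = conj(g(z)) for all z ∈ Ω. Then there exists a function f holomorphic on Ω with exp(f(z)) = g(z) and f(z̄) = conj(f(z)) for all z ∈ Ω if and only if g(x) is a positive real number for every real point x ∈ Ω. -/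
open Complex

/-- Let `Ω ⊆ ℂ` be a nonempty open, connected, simply connected set invariant under
conjugation, and let `g` be holomorphic and nonvanishing on `Ω` with
`g(z̄) = conj (g z)` on `Ω`. Then there is a holomorphic `f` on `Ω` with
`exp ∘ f = g` and `f(z̄) = conj (f z)` on `Ω` iff `g(x) ∈ (0, +∞)` for every real
point `x ∈ Ω`. -/
theorem stmt17 (Ω : Set ℂ) (hne : Ω.Nonempty) (hopen : IsOpen Ω)
    (hconn : IsConnected Ω) (hsc : SimplyConnectedSpace Ω)
    (hsym : ∀ z ∈ Ω, (starRingEnd ℂ) z ∈ Ω)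
    (g : ℂ → ℂ) (hg : DifferentiableOn ℂ g Ω) (hg0 : ∀ z ∈ Ω, g z ≠ 0)
    (hgsym : ∀ z ∈ Ω, g ((starRingEnd ℂ) z) = (starRingEnd ℂ) (g z)) :
    (∃ f : ℂ → ℂ, DifferentiableOn ℂ f Ω ∧
      ∀ z ∈ Ω, Complex.exp (f z) = g z ∧ f ((starRingEnd ℂ) z) = (starRingEnd ℂ) (f z))
    ↔ (∀ x ∈ Ω, x.im = 0 → ∃ r : ℝ, 0 < r ∧ g x = (r : ℂ)) := by
  constructor
  · rintro ⟨f, -, hf⟩ x hx hx0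
    have hc : (starRingEnd ℂ) x = x := conj_eq_iff_im.mpr hx0
    obtain ⟨h1, h2⟩ := hf x hx
    rw [hc] at h2
    obtain ⟨r, hr⟩ := conj_eq_iff_real.mp h2.symm
    refine ⟨Real.exp r, Real.exp_pos r, ?_⟩
    rw [← h1, hr, ofReal_exp]
  · intro hpos
    obtain ⟨f, hfc, hf⟩ := exists_continuousOn_eqOn_exp_comp (U := Ω) hsc hopen
      hg.continuousOn (by rintro ⟨z, hz, h0⟩; exact hg0 z hz h0)
    have hfe : ∀ z ∈ Ω, exp (f z) = g z := fun z hz => hf hz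
    have hfd : DifferentiableOn ℂ f Ω := by
      intro z hz
      have hn := hopen.mem_nhds hz
      have := HasDerivAt.of_comp_left (hfc.continuousAt hn) (hasDerivAt_exp (f z))
        ((hg z hz).differentiableAt hn).hasDerivAt (exp_ne_zero _)
        (Filter.mem_of_superset hn fun w hw => hf hw)
      exact this.differentiableAt.differentiableWithinAt
    -- a real point
    obtain ⟨x, hx, hx0⟩ : ∃ x ∈ Ω, x.im = 0 := by
      obtain ⟨z, hz⟩ := hne
      have hI := hconn.isPreconnected.image im continuous_im.continuousOn
      have h1 : z.im ∈ im '' Ω := ⟨z, hz, rfl⟩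
      have h2 : -z.im ∈ im '' Ω := ⟨_, hsym z hz, by simp⟩
      rcases le_total 0 z.im with h | h
      · exact hI.Icc_subset h2 h1 ⟨by linarith, h⟩
      · exact hI.Icc_subset h1 h2 ⟨h, by linarith⟩
    have hxc : (starRingEnd ℂ) x = x := conj_eq_iff_im.mpr hx0
    obtain ⟨r, hr, hgr⟩ := hpos x hx hx0
    set c : ℂ := f x - (Real.log r : ℂ) with hcdef
    have hc : exp c = 1 := by
      rw [hcdef, exp_sub, hfe x hx, hgr, ← ofReal_exp, Real.exp_log hr, div_self]
      exact_mod_cast hr.ne'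
    set F : ℂ → ℂ := fun z => f z - c with hF
    have hFe : ∀ z ∈ Ω, exp (F z) = g z := fun z hz => by
      simp only [hF, exp_sub, hc, hfe z hz, div_one]
    have hFd : DifferentiableOn ℂ F Ω := hfd.sub_const c
    have hFx : F x = (Real.log r : ℂ) := by simp [hF, hcdef]
    set D : ℂ → ℂ := fun z => F ((starRingEnd ℂ) z) - (starRingEnd ℂ) (F z) with hD
    have hDc : ContinuousOn D Ω := by
      refine ContinuousOn.sub ?_ ?_
      · exact hFd.continuousOn.comp continuous_conj.continuousOn fun z hz => hsym z hz
      · exact continuous_conj.comp_continuousOn hFd.continuousOn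
    have hDn : ∀ z ∈ Ω, ∃ n : ℤ, D z = n * (2 * Real.pi * I) := by
      intro z hz
      apply exp_eq_one_iff.mp
      simp only [hD]
      rw [exp_sub, exp_conj, hFe z hz, hFe _ (hsym z hz), hgsym z hz, div_self]
      simpa using hg0 z hz
    have hT : IsDiscrete (Set.range ((↑) : ℤ → ℝ)) := by
      rw [isDiscrete_iff_discreteTopology]
      exact Int.isClosedEmbedding_coe_real.isEmbedding.toHomeomorph.symm.isEmbedding.discreteTopology
    have hDI : ∀ z ∈ Ω, ∃ n : ℤ, D z = n * (2 * Real.pi * I) ∧ (D z).im / (2 * Real.pi) = n := by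
      intro z hz
      obtain ⟨n, hn⟩ := hDn z hz
      refine ⟨n, hn, ?_⟩
      have : (D z).im = n * (2 * Real.pi) := by rw [hn]; simp
      rw [this, mul_div_cancel_right₀ _ (by positivity)]
    have hD0 : ∀ z ∈ Ω, D z = 0 := by
      intro z hz
      have := hconn.isPreconnected.constant_of_mapsTo hT (f := fun z => (D z).im / (2 * Real.pi))
        ((continuous_im.comp_continuousOn hDc).div_const _)
        (fun w hw => by obtain ⟨n, -, hn⟩ := hDI w hw; exact ⟨n, hn.symm⟩) hz hx
      obtain ⟨n, h1, h2⟩ := hDI z hz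
      have hDx : D x = 0 := by simp only [hD, hxc, hFx, conj_ofReal, sub_self]
      simp only [h2, hDx, zero_im, zero_div] at this
      have hn : n = 0 := by exact_mod_cast this
      rw [h1, hn]; simp
    exact ⟨F, hFd, fun z hz => ⟨hFe z hz, sub_eq_zero.mp (hD0 z hz)⟩⟩
end

section
/- Let U ⊆ ℂ be a nonempty open, connected and simply connected set, let z₀ ∈ U, and let h be a function holomorphic on U with h(z₀) = 1 and h(z) ∉ {1, −1} for every z ∈ U ∖ {z₀}. Then there exists a function G holomorphic on U such that μ(G(z)) = h(z) for all z ∈ U, G(z₀) = 0, and G(z) ≠ k²π² for every z ∈ U and every integer k ≥ 1. -/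
open Complex

open Filter Topology in
lemma mu_fps : HasFPowerSeriesAt μ (FormalMultilinearSeries.ofScalars ℂ
    (fun m : ℕ => ((-1) ^ m / ((2 * m).factorial : ℂ) : ℂ))) 0 := by
  set c : ℕ → ℂ := fun m : ℕ => ((-1) ^ m / ((2 * m).factorial : ℂ) : ℂ) with hc
  have hr : (FormalMultilinearSeries.ofScalars ℂ c).radius = ⊤ := by
    apply FormalMultilinearSeries.ofScalars_radius_eq_top_of_tendsto
    · exact Eventually.of_forall fun n => div_ne_zero (by simp) (by exact_mod_cast Nat.factorial_ne_zero _)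
    · have h1 : ∀ n : ℕ, ‖c n.succ‖ / ‖c n‖ = 1 / ((2 * (n:ℝ) + 2) * (2 * n + 1)) := by
        intro n
        have e : 2 * n.succ = (2 * n + 1) + 1 := by omega
        have hf : ((2 * n).factorial : ℝ) ≠ 0 := by exact_mod_cast Nat.factorial_ne_zero _
        simp only [hc, norm_div, norm_pow, norm_neg, norm_one, one_pow, Complex.norm_natCast]
        rw [e, Nat.factorial_succ, Nat.factorial_succ]
        push_cast
        have h2 : 2 * (n:ℝ) + 1 ≠ 0 := by positivity
        have h3 : 2 * (n:ℝ) + 1 + 1 ≠ 0 := by positivity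
        have h4 : 2 * (n:ℝ) + 2 ≠ 0 := by positivity
        field_simp
        ring
      simp only [h1]
      refine squeeze_zero (fun n => by positivity) (fun n => ?_) tendsto_one_div_add_atTop_nhds_zero_nat
      apply one_div_le_one_div_of_le (by positivity)
      nlinarith [(Nat.cast_nonneg n : (0:ℝ) ≤ n)]
  have h2 := (FormalMultilinearSeries.ofScalars ℂ c).hasFPowerSeriesOnBall (by rw [hr]; simp)
  have h3 : (FormalMultilinearSeries.ofScalars ℂ c).sum = μ := by
    change FormalMultilinearSeries.ofScalarsSum c = μ
    rw [FormalMultilinearSeries.ofScalarsSum_eq_tsum]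
    funext x
    unfold μ
    refine tsum_congr fun m => ?_
    simp only [hc, smul_eq_mul]
    ring
  rw [h3] at h2
  exact h2.hasFPowerSeriesAt

lemma mu_strict : HasStrictDerivAt μ (-1/2) 0 := by
  have := mu_fps.hasStrictDerivAt
  simpa [FormalMultilinearSeries.ofScalars] using this

lemma mu_sq_s18 (x : ℂ) : μ (x ^ 2) = cos x := by
  rw [cos_eq_tsum]; unfold μ
  exact tsum_congr fun m => by rw [pow_mul]

lemma mu_zero : μ 0 = 1 := by
  have := mu_sq_s18 0
  simpa using this

lemma mu_double (w : ℂ) : μ w = 2 * μ (w / 4) ^ 2 - 1 := by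
  obtain ⟨x, rfl⟩ : ∃ x, x ^ 2 = w := ⟨_, Complex.cpow_nat_inv_pow w two_ne_zero⟩
  have e : x ^ 2 / 4 = (x / 2) ^ 2 := by ring
  rw [e, mu_sq_s18, mu_sq_s18, ← cos_two_mul]
  congr 1; ring

open Filter Topology in
lemma mu_inv : ∃ ν : ℂ → ℂ, ∃ ε > 0, ∀ y, ‖y - 1‖ < ε →
    DifferentiableAt ℂ ν y ∧ μ (ν y) = y ∧ ∀ j : ℕ, 0 < (μ (ν y / 4 ^ j)).re := by
  have hne : (-1/2 : ℂ) ≠ 0 := by norm_num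
  set f' := ContinuousLinearEquiv.unitsEquivAut ℂ (Units.mk0 (-1/2 : ℂ) hne) with hf'
  have hcd : ContDiffAt ℂ 1 μ 0 := mu_fps.analyticAt.contDiffAt
  have hF : HasFDerivAt μ (f' : ℂ →L[ℂ] ℂ) 0 := (mu_strict.hasStrictFDerivAt_equiv hne).hasFDerivAt
  set ν := hcd.localInverse hF one_ne_zero with hν
  have h0 : ν 1 = 0 := by
    have := hcd.localInverse_apply_image hF one_ne_zero
    rwa [mu_zero] at this
  have h1 : ContDiffAt ℂ 1 ν 1 := by
    have := hcd.to_localInverse hF one_ne_zero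
    rwa [mu_zero] at this
  have h2 : ∀ᶠ y in 𝓝 (1:ℂ), DifferentiableAt ℂ ν y := by
    filter_upwards [h1.eventually (by simp)] with y hy using hy.differentiableAt one_ne_zero
  have h3 : ∀ᶠ y in 𝓝 (1:ℂ), μ (ν y) = y := by
    have := (hcd.hasStrictFDerivAt' hF one_ne_zero).eventually_right_inverse
    rwa [mu_zero] at this
  have h4 : ∀ᶠ w in 𝓝 (0:ℂ), 0 < (μ w).re := by
    have hc : ContinuousAt (fun w => (μ w).re) 0 :=
      Complex.continuous_re.continuousAt.comp mu_fps.analyticAt.continuousAt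
    exact hc.eventually_const_lt (by simp [mu_zero])
  obtain ⟨δ, hδ, h5⟩ := Metric.eventually_nhds_iff.1 h4
  have h6 : ∀ᶠ y in 𝓝 (1:ℂ), dist (ν y) 0 < δ := by
    have hc := h1.continuousAt
    have := hc.eventually (Metric.ball_mem_nhds _ hδ)
    rw [h0] at this
    exact this
  obtain ⟨ε, hε, h7⟩ := Metric.eventually_nhds_iff.1 (h2.and (h3.and h6))
  refine ⟨ν, ε, hε, fun y hy => ?_⟩
  obtain ⟨a, b, c⟩ := h7 (by rwa [dist_eq_norm])
  refine ⟨a, b, fun j => h5 ?_⟩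
  rw [dist_zero_right] at c ⊢
  rw [norm_div, norm_pow]
  refine lt_of_le_of_lt (div_le_self (norm_nonneg _) ?_) c
  apply one_le_pow₀
  norm_num

open Filter Topology in
lemma mu_lim (w : ℂ) : Tendsto (fun k : ℕ => 4 ^ k * 2 * (1 - μ (w / 4 ^ k))) atTop (𝓝 w) := by
  have h4 : Tendsto (fun k : ℕ => w / 4 ^ k) atTop (𝓝 0) := by
    have : Tendsto (fun k : ℕ => w * (1/4 : ℂ) ^ k) atTop (𝓝 (w * 0)) :=
      (tendsto_pow_atTop_nhds_zero_of_norm_lt_one (by norm_num)).const_mul w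
    simpa [div_eq_mul_inv] using this
  by_cases hw : w = 0
  · subst hw
    simp [mu_zero]
  have h4' : Tendsto (fun k : ℕ => w / 4 ^ k) atTop (𝓝[≠] 0) :=
    tendsto_nhdsWithin_iff.2 ⟨h4, Eventually.of_forall fun k => div_ne_zero hw (by simp)⟩
  have hs := (hasDerivAt_iff_tendsto_slope.1 mu_strict.hasDerivAt).comp h4'
  have := hs.const_mul (-2 * w)
  have e : -2 * w * (-1 / 2) = w := by ring
  rw [e] at this
  refine this.congr fun k => ?_
  simp only [Function.comp, slope_def_field, mu_zero, sub_zero]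
  have : (4 : ℂ) ^ k ≠ 0 := by simp
  field_simp
  ring

/-- A continuous square root of a nonvanishing holomorphic function is holomorphic. -/
lemma diff_of_sq {f g : ℂ → ℂ} {z : ℂ} (hf : ContinuousAt f z) (hz : f z ≠ 0)
    (hg : DifferentiableAt ℂ g z) (hfg : ∀ᶠ w in nhds z, f w ^ 2 = g w) :
    DifferentiableAt ℂ f z := by
  have h1 := hasDerivAt_iff_tendsto_slope.1 hg.hasDerivAt
  have h2 : Filter.Tendsto (fun w => f w + f z) (nhdsWithin z {z}ᶜ) (nhds (f z + f z)) :=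
    (hf.tendsto.mono_left nhdsWithin_le_nhds).add_const _
  have hzz : f z + f z ≠ 0 := by
    rw [← two_mul]; exact mul_ne_zero two_ne_zero hz
  have h3 := h1.div h2 hzz
  have : HasDerivAt f (deriv g z / (f z + f z)) z := by
    rw [hasDerivAt_iff_tendsto_slope]
    refine h3.congr' ?_
    have h4 : ∀ᶠ w in nhdsWithin z {z}ᶜ, f w + f z ≠ 0 := h2.eventually_ne hzz
    filter_upwards [h4, hfg.filter_mono nhdsWithin_le_nhds, self_mem_nhdsWithin] with w hw hw2 hne
    have hne' : w - z ≠ 0 := sub_ne_zero.2 hne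
    rw [Pi.div_apply, slope_def_field, slope_def_field, ← hw2, ← hfg.self_of_nhds]
    field_simp
    ring
  exact this.differentiableAt

lemma half_step {U : Set ℂ} (hopen : IsOpen U) (hsc : SimplyConnectedSpace U)
    {z₀ : ℂ} (hz₀ : z₀ ∈ U) (h : ℂ → ℂ)
    (H : DifferentiableOn ℂ h U ∧ h z₀ = 1 ∧ ∀ z ∈ U, z ≠ z₀ → h z ≠ 1 ∧ h z ≠ -1) :
    ∃ c : ℂ → ℂ, (DifferentiableOn ℂ c U ∧ c z₀ = 1 ∧ ∀ z ∈ U, z ≠ z₀ → c z ≠ 1 ∧ c z ≠ -1) ∧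
      ∀ z ∈ U, 2 * c z ^ 2 - 1 = h z := by
  obtain ⟨hd, h0, h1⟩ := H
  have hU : IsSimplyConnected U := hsc
  have hm1 : ∀ z ∈ U, h z ≠ -1 := by
    intro z hz
    by_cases e : z = z₀
    · rw [e, h0]; norm_num
    · exact (h1 z hz e).2
  have hgd : DifferentiableOn ℂ (fun z => (h z + 1) / 2) U := (hd.add_const 1).div_const 2
  obtain ⟨f, hfc, hf⟩ := Complex.exists_continuousOn_pow_eq hU hopen (g := fun z => (h z + 1) / 2)
    hgd.continuousOn (by
      rintro ⟨z, hz, e⟩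
      apply hm1 z hz
      linear_combination 2 * e) two_ne_zero
  have hfne : ∀ z ∈ U, f z ≠ 0 := by
    intro z hz e
    have := hf z
    rw [e] at this
    apply hm1 z hz
    linear_combination -2 * this
  have hfd : DifferentiableOn ℂ f U := fun z hz =>
    (diff_of_sq (hfc.continuousAt (hopen.mem_nhds hz)) (hfne z hz)
      (hgd.differentiableAt (hopen.mem_nhds hz)) (Filter.Eventually.of_forall hf)).differentiableWithinAt
  have hs : f z₀ ^ 2 = 1 := by rw [hf, h0]; norm_num
  refine ⟨fun z => f z₀ * f z, ⟨hfd.const_mul _, by simp only [← sq]; exact hs, ?_⟩, ?_⟩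
  · intro z hz hne
    have key : (f z₀ * f z) ^ 2 = 1 → False := by
      intro e
      rw [mul_pow, hs, one_mul, hf z] at e
      apply (h1 z hz hne).1
      linear_combination 2 * e
    refine ⟨fun e => key ?_, fun e => key ?_⟩ <;> (simp only at e; rw [e]; norm_num)
  · intro z hz
    simp only [mul_pow, hs, hf z]
    ring

lemma near_one {ε : ℝ} (hε2 : ε ≤ 1/2) {U : Set ℂ} (hopen : IsOpen U)
    {s : ℕ → ℂ → ℂ} (hs : ∀ k, ContinuousOn (s k) U)
    (hrec : ∀ k, ∀ z ∈ U, 2 * s (k+1) z ^ 2 - 1 = s k z) {z₁ : ℂ} (hz : z₁ ∈ U) {K : ℕ}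
    (hK : ∀ k ≥ K, ‖s k z₁ - 1‖ < ε) :
    ∃ r > 0, Metric.ball z₁ r ⊆ U ∧ ∀ k ≥ K, ∀ z ∈ Metric.ball z₁ r, ‖s k z - 1‖ < ε := by
  have h1 : ∀ᶠ z in nhds z₁, ‖s K z - 1‖ < ε :=
    (((hs K).continuousAt (hopen.mem_nhds hz)).sub_const 1).norm.eventually_lt_const (hK K le_rfl)
  obtain ⟨r, hr, hb⟩ := Metric.eventually_nhds_iff_ball.1 (h1.and (hopen.mem_nhds hz))
  have hBU : Metric.ball z₁ r ⊆ U := fun z hz => (hb z hz).2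
  refine ⟨r, hr, hBU, fun k hk => ?_⟩
  induction k, hk using Nat.le_induction with
  | base => exact fun z hz => (hb z hz).1
  | succ k hk ih =>
    have re0 : ∀ z ∈ Metric.ball z₁ r, (s (k+1) z).re ≠ 0 := by
      intro z hz e
      have h2 := hrec k z (hBU hz)
      have h3 := congrArg Complex.re h2
      have h4 := (Complex.abs_re_le_norm (s k z - 1)).trans_lt (ih z hz)
      rw [abs_lt] at h4
      simp [sq, e] at h3 h4
      nlinarith [mul_self_nonneg (s (k+1) z).im]
    have hpos1 : 0 < (s (k+1) z₁).re := by
      have h4 := (Complex.abs_re_le_norm (s (k+1) z₁ - 1)).trans_lt (hK (k+1) (by omega))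
      rw [abs_lt] at h4
      simp at h4
      linarith
    intro z hz
    have hpos : 0 < (s (k+1) z).re := by
      by_contra hn
      push Not at hn
      have hpc : IsPreconnected (Metric.ball z₁ r) := (convex_ball z₁ r).isPreconnected
      obtain ⟨w, hw, e⟩ := hpc.intermediate_value hz (Metric.mem_ball_self hr)
        (f := fun z => (s (k+1) z).re)
        (Complex.continuous_re.comp_continuousOn ((hs (k+1)).mono hBU)) ⟨hn, hpos1.le⟩
      exact re0 w hw e
    have h2 := hrec k z (hBU hz)
    have h5 : (s (k+1) z - 1) * (s (k+1) z + 1) * 2 = s k z - 1 := by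
      linear_combination h2
    have h6 : 1 ≤ ‖s (k+1) z + 1‖ := by
      refine le_trans ?_ (Complex.re_le_norm _)
      simp; linarith
    have h7 := congrArg norm h5
    rw [norm_mul, norm_mul] at h7
    have h8 := ih z hz
    simp at h7
    nlinarith [norm_nonneg (s (k+1) z - 1)]

lemma ball_sc (x : ℂ) {r : ℝ} (hr : 0 < r) : IsSimplyConnected (Metric.ball x r) := by
  have : ContractibleSpace (Metric.ball x r) :=
    (convex_ball x r).contractibleSpace ⟨x, Metric.mem_ball_self hr⟩
  change SimplyConnectedSpace _
  infer_instance

lemma exists_arccos {z₁ : ℂ} {r : ℝ} (hr : 0 < r) {h : ℂ → ℂ}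
    (hc : ContinuousOn h (Metric.ball z₁ r)) (h1 : ∀ z ∈ Metric.ball z₁ r, h z ≠ 1 ∧ h z ≠ -1) :
    ∃ x : ℂ → ℂ, ContinuousOn x (Metric.ball z₁ r) ∧ ∀ z ∈ Metric.ball z₁ r, cos (x z) = h z := by
  obtain ⟨f, hfc, hf⟩ := Complex.exists_continuousOn_pow_eq (ball_sc z₁ hr) Metric.isOpen_ball
    (g := fun z => h z ^ 2 - 1) ((hc.pow 2).sub continuousOn_const) (by
      rintro ⟨z, hz, e⟩
      have : (h z - 1) * (h z + 1) = 0 := by linear_combination e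
      rcases mul_eq_zero.1 this with e | e
      · exact (h1 z hz).1 (by linear_combination e)
      · exact (h1 z hz).2 (by linear_combination e)) two_ne_zero
  have hw : ∀ z, (h z + f z) * (h z - f z) = 1 := fun z => by linear_combination -hf z
  obtain ⟨L, hL, hLe⟩ := Complex.exists_continuousOn_eqOn_exp_comp (ball_sc z₁ hr)
    Metric.isOpen_ball (g := fun z => h z + f z) (hc.add hfc) (by
      rintro ⟨z, hz, e⟩
      have := hw z
      simp only at e
      rw [e] at this
      simp at this)
  refine ⟨fun z => L z * I, hL.mul continuousOn_const, fun z hz => ?_⟩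
  have e1 : exp (L z) = h z + f z := hLe hz
  have e2 : exp (-L z) = h z - f z := by
    rw [Complex.exp_neg, e1]
    exact inv_eq_of_mul_eq_one_right (hw z)
  rw [Complex.cos_mul_I, Complex.cosh, e1, e2]
  ring

open Filter Topology in
lemma same_status {z₁ : ℂ} {r : ℝ} (hr : 0 < r)
    {s : ℕ → ℂ → ℂ} (hs : ∀ k, ContinuousOn (s k) (Metric.ball z₁ r))
    (hrec : ∀ k, ∀ z ∈ Metric.ball z₁ r, 2 * s (k+1) z ^ 2 - 1 = s k z)
    (h1 : ∀ k, ∀ z ∈ Metric.ball z₁ r, s k z ≠ 1 ∧ s k z ≠ -1) {z z' : ℂ}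
    (hz : z ∈ Metric.ball z₁ r) (hz' : z' ∈ Metric.ball z₁ r)
    (hlim : Tendsto (fun k => s k z) atTop (𝓝 1)) :
    Tendsto (fun k => s k z') atTop (𝓝 1) := by
  obtain ⟨x, hx, hxc⟩ := exists_arccos hr (hs 0) (h1 0)
  have key : ∀ k, ∃ c : ℂ, ∀ w ∈ Metric.ball z₁ r, cos (x w / 2 ^ k + c) = s k w := by
    intro k
    induction k with
    | zero => exact ⟨0, by simpa using hxc⟩
    | succ k ih =>
      obtain ⟨c, hc⟩ := ih
      have hpc : IsPreconnected (Metric.ball z₁ r) := (convex_ball z₁ r).isPreconnected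
      have hcc : ContinuousOn (fun w => cos (x w / 2 ^ (k+1) + c / 2)) (Metric.ball z₁ r) :=
        Complex.continuous_cos.comp_continuousOn
          ((hx.div_const _).add continuousOn_const)
      have hsq : ∀ w ∈ Metric.ball z₁ r, cos (x w / 2 ^ (k+1) + c / 2) ^ 2 = s (k+1) w ^ 2 := by
        intro w hw
        have e := Complex.cos_two_mul (x w / 2 ^ (k+1) + c / 2)
        have e2 : 2 * (x w / 2 ^ (k+1) + c / 2) = x w / 2 ^ k + c := by
          rw [pow_succ]; field_simp
        rw [e2, hc w hw, ← hrec k w hw] at e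
        linear_combination -e / 2
      rcases hpc.eq_or_eq_neg_of_sq_eq hcc (hs (k+1)) (fun w hw => hsq w hw) (by
        intro w hw e
        have := hrec k w hw
        rw [e] at this
        exact (h1 k w hw).2 (by linear_combination -this)) with e | e
      · exact ⟨c / 2, fun w hw => e hw⟩
      · refine ⟨c / 2 + Real.pi, fun w hw => ?_⟩
        have := e hw
        rw [← add_assoc, Complex.cos_add_pi]
        simp only [Pi.neg_apply] at this
        rw [this, neg_neg]
  choose c hc using key
  have hδ : Tendsto (fun k : ℕ => (x z' - x z) / 2 ^ k) atTop (𝓝 0) := by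
    have : Tendsto (fun k : ℕ => (x z' - x z) * (1/2 : ℂ) ^ k) atTop (𝓝 ((x z' - x z) * 0)) :=
      (tendsto_pow_atTop_nhds_zero_of_norm_lt_one (by norm_num)).const_mul _
    simpa [div_eq_mul_inv] using this
  have hcos : Tendsto (fun k : ℕ => cos ((x z' - x z) / 2 ^ k)) atTop (𝓝 1) := by
    simpa [Function.comp_def] using (Complex.continuous_cos.tendsto 0).comp hδ
  have hsin : Tendsto (fun k : ℕ => sin ((x z' - x z) / 2 ^ k)) atTop (𝓝 0) := by
    simpa [Function.comp_def] using (Complex.continuous_sin.tendsto 0).comp hδ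
  have hsa : Tendsto (fun k : ℕ => sin (x z / 2 ^ k + c k)) atTop (𝓝 0) := by
    have h2 : Tendsto (fun k : ℕ => sin (x z / 2 ^ k + c k) ^ 2) atTop (𝓝 0) := by
      have := (hlim.pow 2).const_sub 1
      simp only [one_pow, sub_self] at this
      refine this.congr fun k => ?_
      rw [Complex.sin_sq, hc k z hz]
    rw [tendsto_zero_iff_norm_tendsto_zero] at h2 ⊢
    have h3 := (Real.continuous_sqrt.tendsto 0).comp h2
    simp only [Real.sqrt_zero] at h3
    refine h3.congr fun k => ?_
    simp [norm_pow]
  have := (hlim.mul hcos).sub (hsa.mul hsin)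
  simp only [mul_one, mul_zero, sub_zero] at this
  refine this.congr fun k => ?_
  rw [← hc k z hz, ← Complex.cos_add, ← hc k z' hz']
  congr 1; ring

open Filter Topology in
lemma all_lim {U : Set ℂ} (hopen : IsOpen U) (hconn : IsConnected U) {z₀ : ℂ} (hz₀ : z₀ ∈ U)
    {s : ℕ → ℂ → ℂ} (hs : ∀ k, ContinuousOn (s k) U)
    (hrec : ∀ k, ∀ z ∈ U, 2 * s (k+1) z ^ 2 - 1 = s k z) (h0 : ∀ k, s k z₀ = 1)
    (h1 : ∀ k, ∀ z ∈ U, z ≠ z₀ → s k z ≠ 1 ∧ s k z ≠ -1) {z : ℂ} (hz : z ∈ U) :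
    Tendsto (fun k => s k z) atTop (𝓝 1) := by
  have hz0lim : Tendsto (fun k => s k z₀) atTop (𝓝 1) := by simp [h0]
  refine (hconn.isPreconnected.induction₂ (fun a b => Tendsto (fun k => s k a) atTop (𝓝 1) ↔
    Tendsto (fun k => s k b) atTop (𝓝 1)) ?_ (fun _ _ _ _ _ _ => Iff.trans)
    (fun _ _ _ _ => Iff.symm) hz₀ hz).1 hz0lim
  intro a ha
  apply Filter.Eventually.filter_mono nhdsWithin_le_nhds
  by_cases e : a = z₀
  · subst e
    -- all the iterates are uniformly close to one near the base point
    obtain ⟨r, hr, hrU, hb⟩ := near_one (ε := 1/2) le_rfl hopen hs hrec ha (K := 0)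
      (fun k _ => by rw [h0]; norm_num)
    filter_upwards [Metric.ball_mem_nhds a hr] with b hbm
    refine ⟨fun _ => ?_, fun _ => hz0lim⟩
    have hbd : ∀ k : ℕ, ‖s k b - 1‖ ≤ (1/2) ^ k := by
      intro k
      induction k with
      | zero => have := hb 0 le_rfl b hbm; norm_num at this ⊢; linarith
      | succ k ih =>
        have h2 := hrec k b (hrU hbm)
        have h5 : (s (k+1) b - 1) * (s (k+1) b + 1) * 2 = s k b - 1 := by
          linear_combination h2
        have h4 := (Complex.abs_re_le_norm (s (k+1) b - 1)).trans_lt (hb (k+1) (by omega) b hbm)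
        rw [abs_lt] at h4
        simp at h4
        have h6 : 1 ≤ ‖s (k+1) b + 1‖ := by
          refine le_trans ?_ (Complex.re_le_norm _)
          simp; linarith
        have h7 := congrArg norm h5
        rw [norm_mul, norm_mul] at h7
        simp only [Complex.norm_ofNat] at h7
        rw [pow_succ]
        nlinarith [norm_nonneg (s (k+1) b - 1)]
    rw [tendsto_iff_norm_sub_tendsto_zero]
    exact squeeze_zero (fun _ => norm_nonneg _) hbd
      (tendsto_pow_atTop_nhds_zero_of_lt_one (by norm_num) (by norm_num))
  · have hev : ∀ᶠ w in 𝓝 a, w ∈ U ∧ w ≠ z₀ :=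
      (hopen.eventually_mem ha).and (isOpen_ne.eventually_mem e)
    obtain ⟨r, hr, hb⟩ := Metric.eventually_nhds_iff_ball.1 hev
    have hBU : Metric.ball a r ⊆ U := fun z hz => (hb z hz).1
    filter_upwards [Metric.ball_mem_nhds a hr] with b hbm
    have gen := fun {z z' : ℂ} (hz : z ∈ Metric.ball a r) (hz' : z' ∈ Metric.ball a r) =>
      same_status hr (fun k => (hs k).mono hBU) (fun k z hz => hrec k z (hBU hz))
        (fun k z hz => h1 k z (hBU hz) (hb z hz).2) hz hz'
    exact ⟨gen (Metric.mem_ball_self hr) hbm, gen hbm (Metric.mem_ball_self hr)⟩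

open Filter Topology in
lemma local_G {U : Set ℂ} (hopen : IsOpen U)
    {s : ℕ → ℂ → ℂ} (hs : ∀ k, DifferentiableOn ℂ (s k) U)
    (hrec : ∀ k, ∀ z ∈ U, 2 * s (k+1) z ^ 2 - 1 = s k z) {z₁ : ℂ} (hz : z₁ ∈ U)
    (hlim : Tendsto (fun k => s k z₁) atTop (𝓝 1)) :
    ∃ F : ℂ → ℂ, DifferentiableAt ℂ F z₁ ∧ ∀ᶠ z in 𝓝 z₁, μ (F z) = s 0 z ∧
      Tendsto (fun k : ℕ => 4 ^ k * 2 * (1 - s k z)) atTop (𝓝 (F z)) := by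
  obtain ⟨ν, ε, hε, hν⟩ := mu_inv
  have hε' : 0 < min ε (1/2) := by positivity
  obtain ⟨K, hK⟩ := eventually_atTop.1 (hlim.eventually (Metric.ball_mem_nhds 1 hε'))
  obtain ⟨r, hr, hrU, hb⟩ := near_one (min_le_right ε (1/2)) hopen (fun k => (hs k).continuousOn)
    hrec hz (K := K) (fun k hk => by simpa [dist_eq_norm] using hK k hk)
  refine ⟨fun z => 4 ^ K * ν (s K z), ?_, ?_⟩
  · refine DifferentiableAt.const_mul ?_ _
    exact DifferentiableAt.comp z₁ (hν _ ((hb K le_rfl z₁ (Metric.mem_ball_self hr)).trans_le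
      (min_le_left _ _))).1 ((hs K).differentiableAt (hopen.mem_nhds hz))
  filter_upwards [Metric.ball_mem_nhds z₁ hr] with z hzb
  obtain ⟨-, hinv, hre⟩ := hν _ ((hb K le_rfl z hzb).trans_le (min_le_left _ _))
  have up : ∀ j : ℕ, μ (ν (s K z) / 4 ^ j) = s (K + j) z := by
    intro j
    induction j with
    | zero => simpa using hinv
    | succ j ih =>
      have h1 := mu_double (ν (s K z) / 4 ^ j)
      have e : ν (s K z) / 4 ^ j / 4 = ν (s K z) / 4 ^ (j+1) := by
        rw [pow_succ, div_div]
      rw [e, ih, ← hrec (K + j) z (hrU hzb)] at h1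
      have h2 : s (K + j + 1) z ^ 2 = μ (ν (s K z) / 4 ^ (j+1)) ^ 2 := by
        linear_combination h1 / 2
      rcases sq_eq_sq_iff_eq_or_eq_neg.1 h2 with h3 | h3
      · exact h3.symm
      · exfalso
        have h4 := (Complex.abs_re_le_norm (s (K+j+1) z - 1)).trans_lt
          ((hb (K+j+1) (by omega) z hzb).trans_le (min_le_right _ _))
        have h5 := hre (j+1)
        rw [abs_lt] at h4
        rw [h3] at h4
        simp at h4
        linarith
  set w := 4 ^ K * ν (s K z) with hw
  have up' : ∀ k ≥ K, μ (w / 4 ^ k) = s k z := by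
    intro k hk
    obtain ⟨j, rfl⟩ := Nat.exists_eq_add_of_le hk
    rw [← up j, hw, pow_add]
    congr 1
    field_simp
  have down : ∀ i k : ℕ, μ (w / 4 ^ (k + i)) = s (k + i) z → μ (w / 4 ^ k) = s k z := by
    intro i
    induction i with
    | zero => intro k h; simpa using h
    | succ i ih =>
      intro k h
      apply ih
      rw [mu_double, div_div, ← pow_succ, ← hrec (k+i) z (hrU hzb)]
      rw [← add_assoc] at h
      rw [h]
  refine ⟨by simpa using down K 0 (up' (0 + K) (by omega)), ?_⟩
  refine (mu_lim w).congr' ?_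
  filter_upwards [eventually_ge_atTop K] with k hk
  rw [up' k hk]

/-- Let `U ⊆ ℂ` be a nonempty open, connected, simply connected set, `z₀ ∈ U`, and `h`
holomorphic on `U` with `h(z₀) = 1` and `h(z) ∉ {1, −1}` for `z ∈ U ∖ {z₀}`. Then there
is a holomorphic `G` on `U` with `μ ∘ G = h` on `U`, `G(z₀) = 0`, and `G(z) ≠ k²π²` for
every `z ∈ U` and integer `k ≥ 1`. -/
theorem stmt18 (U : Set ℂ) (hne : U.Nonempty) (hopen : IsOpen U)
    (hconn : IsConnected U) (hsc : SimplyConnectedSpace U)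
    (z₀ : ℂ) (hz₀ : z₀ ∈ U)
    (h : ℂ → ℂ) (hh : DifferentiableOn ℂ h U) (hh1 : h z₀ = 1)
    (hne1 : ∀ z ∈ U, z ≠ z₀ → h z ≠ 1 ∧ h z ≠ -1) :
    ∃ G : ℂ → ℂ, DifferentiableOn ℂ G U ∧ (∀ z ∈ U, μ (G z) = h z) ∧ G z₀ = 0 ∧
      ∀ z ∈ U, ∀ k : ℕ, 1 ≤ k → G z ≠ (k : ℂ) ^ 2 * (Real.pi : ℂ) ^ 2 := by
  let T := {h : ℂ → ℂ // DifferentiableOn ℂ h U ∧ h z₀ = 1 ∧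
    ∀ z ∈ U, z ≠ z₀ → h z ≠ 1 ∧ h z ≠ -1}
  have step : ∀ t : T, ∃ c : T, ∀ z ∈ U, 2 * c.1 z ^ 2 - 1 = t.1 z := by
    intro t
    obtain ⟨c, hc, hc2⟩ := half_step hopen hsc hz₀ t.1 t.2
    exact ⟨⟨c, hc⟩, hc2⟩
  choose nx hnx using step
  let q : ℕ → T := fun k => Nat.rec ⟨h, hh, hh1, hne1⟩ (fun _ t => nx t) k
  let s : ℕ → ℂ → ℂ := fun k => (q k).1
  have s0 : s 0 = h := rfl
  have hrec : ∀ k, ∀ z ∈ U, 2 * s (k+1) z ^ 2 - 1 = s k z := fun k => hnx (q k)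
  have hsd : ∀ k, DifferentiableOn ℂ (s k) U := fun k => (q k).2.1
  have hs1 : ∀ k, s k z₀ = 1 := fun k => (q k).2.2.1
  have hsn : ∀ k, ∀ z ∈ U, z ≠ z₀ → s k z ≠ 1 ∧ s k z ≠ -1 := fun k => (q k).2.2.2
  have loc := fun (z : ℂ) (hz : z ∈ U) => local_G hopen hsd hrec hz
    (all_lim hopen hconn hz₀ (fun k => (hsd k).continuousOn) hrec hs1 hsn hz)
  let G : ℂ → ℂ := fun z => Filter.limUnder Filter.atTop (fun k : ℕ => 4 ^ k * 2 * (1 - s k z))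
  have hμ : ∀ z ∈ U, μ (G z) = h z := by
    intro z hz
    obtain ⟨F, -, hF⟩ := loc z hz
    obtain ⟨h1, h2⟩ := hF.self_of_nhds
    have : G z = F z := h2.limUnder_eq
    rw [this, h1, s0]
  have hG0 : G z₀ = 0 := by
    have : Filter.Tendsto (fun k : ℕ => 4 ^ k * 2 * (1 - s k z₀)) Filter.atTop (nhds 0) := by
      simp [hs1]
    exact this.limUnder_eq
  refine ⟨G, ?_, hμ, hG0, ?_⟩
  · intro z hz
    obtain ⟨F, hFd, hF⟩ := loc z hz
    refine (hFd.congr_of_eventuallyEq ?_).differentiableWithinAt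
    filter_upwards [hF] with w hw
    exact hw.2.limUnder_eq
  · intro z hz k hk e
    have hpi : (k : ℂ) ^ 2 * (Real.pi : ℂ) ^ 2 ≠ 0 := by
      have : (k : ℂ) ≠ 0 := by exact_mod_cast (by omega : k ≠ 0)
      have : (Real.pi : ℂ) ≠ 0 := by exact_mod_cast Real.pi_ne_zero
      positivity
    by_cases hzz : z = z₀
    · rw [hzz, hG0] at e
      exact hpi e.symm
    · have h1 := hμ z hz
      rw [e, ← mul_pow, mu_sq_s18] at h1
      have h2 : h z ^ 2 = 1 := by
        have h3 := Complex.sin_nat_mul_pi k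
        have h4 := Complex.sin_sq_add_cos_sq ((k : ℂ) * (Real.pi : ℂ))
        rw [h3, h1] at h4
        linear_combination h4
      rcases (by simpa using h2 : h z = 1 ∨ h z = -1) with h5 | h5
      · exact (hne1 z hz hzz).1 h5
      · exact (hne1 z hz hzz).2 h5
end
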